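/- Let n ≥ 1, let 1 ≤ p < ∞ and let E be a Köthe sequence space. Let X_1,…,X_n, Y_1,…,Y_n, Y be Banach spaces, let T : Y_1 × ⋯ × Y_n → Y be a bounded n-linear map, and for each j = 1,…,n let A_j : X_j → Y_j be a bounded linear operator satisfying the (E^{1/n},p)-summing inequality with constant C_j. Then the n-linear map T∘(A_1,…,A_n) : X_1 × ⋯ × X_n → Y satisfies the (E,p)-summing inequality with constant ‖T‖·C_1⋯C_n. -/

import Mathlib

/-- A Köthe sequence space: a linear subspace of `ℂ^ℕ` with a complete norm such that
`ℓ₁ ⊆ E ⊆ ℓ_∞` with inclusions of norm at most 1, and which is normal. -/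
structure KotheSpace : Type where
  Mem : (ℕ → ℂ) → Prop
  nrm : (ℕ → ℂ) → ℝ
  mem_zero : Mem 0
  mem_add : ∀ {x y : ℕ → ℂ}, Mem x → Mem y → Mem (x + y)
  mem_smul : ∀ (c : ℂ) {x : ℕ → ℂ}, Mem x → Mem (c • x)
  nrm_add_le : ∀ {x y : ℕ → ℂ}, Mem x → Mem y → nrm (x + y) ≤ nrm x + nrm y
  nrm_smul : ∀ (c : ℂ) {x : ℕ → ℂ}, Mem x → nrm (c • x) = ‖c‖ * nrm x
  nrm_eq_zero_iff : ∀ {x : ℕ → ℂ}, Mem x → (nrm x = 0 ↔ x = 0)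
  l1_mem : ∀ {x : ℕ → ℂ}, Summable (fun k => ‖x k‖) → Mem x
  nrm_le_l1 : ∀ {x : ℕ → ℂ}, Summable (fun k => ‖x k‖) → nrm x ≤ ∑' k, ‖x k‖
  coord_le_nrm : ∀ {x : ℕ → ℂ}, Mem x → ∀ k, ‖x k‖ ≤ nrm x
  normal_mem : ∀ {x y : ℕ → ℂ}, Mem y → (∀ k, ‖x k‖ ≤ ‖y k‖) → Mem x
  normal_nrm : ∀ {x y : ℕ → ℂ}, Mem x → Mem y → (∀ k, ‖x k‖ ≤ ‖y k‖) → nrm x ≤ nrm y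
  complete : ∀ f : ℕ → ℕ → ℂ, (∀ i, Mem (f i)) →
    (∀ ε : ℝ, 0 < ε → ∃ N, ∀ i, N ≤ i → ∀ j, N ≤ j → nrm (f i - f j) < ε) →
    ∃ g, Mem g ∧ ∀ ε : ℝ, 0 < ε → ∃ N, ∀ i, N ≤ i → nrm (f i - g) < ε

namespace KotheSpace

/-- Membership in the Köthe dual `E^×`. -/
def dualMem (E : KotheSpace) (z : ℕ → ℂ) : Prop :=
  ∀ x, E.Mem x → Summable fun k => ‖z k * x k‖

/-- The norm of the Köthe dual `E^×`. -/
noncomputable def dualNrm (E : KotheSpace) (z : ℕ → ℂ) : ℝ :=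
  sSup {r | ∃ x, E.Mem x ∧ E.nrm x ≤ 1 ∧ r = ∑' k, ‖z k * x k‖}

/-- Membership in the Köthe bidual `E^××`. -/
def bidualMem (E : KotheSpace) (z : ℕ → ℂ) : Prop :=
  ∀ w, E.dualMem w → Summable fun k => ‖z k * w k‖

/-- The norm of the Köthe bidual `E^××`. -/
noncomputable def bidualNrm (E : KotheSpace) (z : ℕ → ℂ) : ℝ :=
  sSup {r | ∃ w, E.dualMem w ∧ E.dualNrm w ≤ 1 ∧ r = ∑' k, ‖z k * w k‖}

end KotheSpace

namespace KotheSpace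

/-- Membership in the `1/n`-convexification `E^{1/n}`: sequences `x` with `(|x(k)|^n)_k ∈ E`. -/
def convMem (E : KotheSpace) (n : ℕ) (x : ℕ → ℂ) : Prop :=
  E.Mem (fun k => Complex.ofReal (‖x k‖ ^ n))

/-- The norm of the `1/n`-convexification: `‖x‖_{E^{1/n}} = ‖(|x(k)|^n)_k‖_E ^ (1/n)`. -/
noncomputable def convNrm (E : KotheSpace) (n : ℕ) (x : ℕ → ℂ) : ℝ :=
  E.nrm (fun k => Complex.ofReal (‖x k‖ ^ n)) ^ ((1 : ℝ) / n)

end KotheSpace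

open scoped BigOperators

/-- The weak `ℓ_p` norm of a finite family in a Banach space:
`w_p(x) = sup{(∑_i ‖x'(x_i)‖^p)^{1/p} : x' ∈ X', ‖x'‖ ≤ 1}`. -/
noncomputable def weakLp (p : ℝ) {X : Type*} [NormedAddCommGroup X] [NormedSpace ℂ X]
    {m : ℕ} (x : Fin m → X) : ℝ :=
  sSup {r | ∃ f : X →L[ℂ] ℂ, ‖f‖ ≤ 1 ∧ r = (∑ i, ‖f (x i)‖ ^ p) ^ (1 / p)}

/-- A bounded `n`-linear map `T` satisfies the `(H,p)`-summing inequality with constant `C`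
(where `H` is given by a membership predicate `HMem` and a norm `Hnrm` on `ℂ^ℕ`):
for all finite families the finitely supported sequence `i ↦ ‖T(x_{1,i},…,x_{n,i})‖`
belongs to `H` with `H`-norm at most `C·w_p(x_1)⋯w_p(x_n)`. -/
def SummingIneq (HMem : (ℕ → ℂ) → Prop) (Hnrm : (ℕ → ℂ) → ℝ) (p : ℝ) {n : ℕ}
    {X : Fin n → Type*} [∀ j, NormedAddCommGroup (X j)] [∀ j, NormedSpace ℂ (X j)]
    {Y : Type*} [NormedAddCommGroup Y] [NormedSpace ℂ Y]
    (T : ContinuousMultilinearMap ℂ X Y) (C : ℝ) : Prop :=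
  ∀ (m : ℕ) (x : ∀ j, Fin m → X j),
    HMem (fun i => if h : i < m then Complex.ofReal ‖T (fun j => x j ⟨i, h⟩)‖ else 0) ∧
    Hnrm (fun i => if h : i < m then Complex.ofReal ‖T (fun j => x j ⟨i, h⟩)‖ else 0) ≤
      C * ∏ j, weakLp p (x j)

/-- The `(H,p)`-summing inequality with constant `C` for a linear operator. -/
def SummingIneqLin (HMem : (ℕ → ℂ) → Prop) (Hnrm : (ℕ → ℂ) → ℝ) (p : ℝ)
    {X Y : Type*} [NormedAddCommGroup X] [NormedSpace ℂ X]
    [NormedAddCommGroup Y] [NormedSpace ℂ Y] (A : X →L[ℂ] Y) (C : ℝ) : Prop :=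
  ∀ (m : ℕ) (x : Fin m → X),
    HMem (fun i => if h : i < m then Complex.ofReal ‖A (x ⟨i, h⟩)‖ else 0) ∧
    Hnrm (fun i => if h : i < m then Complex.ofReal ‖A (x ⟨i, h⟩)‖ else 0) ≤ C * weakLp p x

namespace KotheSpace

lemma nrm_nonneg (E : KotheSpace) {x : ℕ → ℂ} (hx : E.Mem x) : 0 ≤ E.nrm x :=
  (norm_nonneg _).trans (E.coord_le_nrm hx 0)

lemma nrm_zero (E : KotheSpace) : E.nrm 0 = 0 :=
  (E.nrm_eq_zero_iff E.mem_zero).2 rfl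

lemma mem_sum_and_nrm_sum_le (E : KotheSpace) {ι : Type*} (s : Finset ι) (x : ι → ℕ → ℂ)
    (hx : ∀ j, E.Mem (x j)) :
    E.Mem (∑ j ∈ s, x j) ∧ E.nrm (∑ j ∈ s, x j) ≤ ∑ j ∈ s, E.nrm (x j) := by
  classical
  induction s using Finset.induction_on with
  | empty => simpa using ⟨E.mem_zero, E.nrm_zero.le⟩
  | insert j s hj ih =>
    rw [Finset.sum_insert hj, Finset.sum_insert hj]
    exact ⟨E.mem_add (hx j) ih.1, (E.nrm_add_le (hx j) ih.1).trans (by gcongr; exact ih.2)⟩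

/-- The arithmetic-geometric mean inequality in a Köthe sequence space. -/
lemma mem_prod_and_nrm_prod_le_mean (E : KotheSpace) {n : ℕ} (hn : 1 ≤ n) (a : Fin n → ℕ → ℂ)
    (ha : ∀ j, E.convMem n (a j)) :
    E.Mem (fun k => ∏ j, a j k) ∧ E.nrm (fun k => ∏ j, a j k) ≤
      (n : ℝ)⁻¹ * ∑ j, E.nrm (fun k => Complex.ofReal (‖a j k‖ ^ n)) := by
  have hn0 : n ≠ 0 := by omega
  obtain ⟨hmem, hle⟩ := E.mem_sum_and_nrm_sum_le Finset.univ
    (fun j k => Complex.ofReal (‖a j k‖ ^ n)) ha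
  have hle' : ∀ k, ‖∏ j, a j k‖ ≤
      ‖(((n : ℂ)⁻¹) • ∑ j, fun k => Complex.ofReal (‖a j k‖ ^ n)) k‖ := by
    intro k
    have hk := Real.geom_mean_le_arith_mean_weighted Finset.univ (fun _ : Fin n => (n : ℝ)⁻¹)
      (fun j => ‖a j k‖ ^ n) (fun _ _ => by positivity) (by simp [hn0])
      (fun _ _ => by positivity)
    simp only [Real.pow_rpow_inv_natCast (norm_nonneg _) hn0, ← Finset.mul_sum] at hk
    rw [norm_prod, Pi.smul_apply, Finset.sum_apply, ← Complex.ofReal_sum, norm_smul, norm_inv,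
      Complex.norm_natCast, Complex.norm_real, Real.norm_of_nonneg (by positivity)]
    exact hk
  have hmem' := E.mem_smul ((n : ℂ)⁻¹) hmem
  have hprod := E.normal_mem hmem' hle'
  refine ⟨hprod, (E.normal_nrm hprod hmem' hle').trans ?_⟩
  rw [E.nrm_smul _ hmem, norm_inv, Complex.norm_natCast]
  gcongr

/-- Hölder's inequality for the `1/n`-convexification. -/
lemma nrm_prod_le_prod_convNrm (E : KotheSpace) {n : ℕ} (hn : 1 ≤ n) (a : Fin n → ℕ → ℂ)
    (ha : ∀ j, E.convMem n (a j)) :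
    E.nrm (fun k => ∏ j, a j k) ≤ ∏ j, E.convNrm n (a j) := by
  have hn0 : n ≠ 0 := by omega
  have hnonneg : ∀ j, 0 ≤ E.convNrm n (a j) := fun j => Real.rpow_nonneg (E.nrm_nonneg (ha j)) _
  have hpow : ∀ j, E.convNrm n (a j) ^ n = E.nrm (fun k => Complex.ofReal (‖a j k‖ ^ n)) := by
    intro j
    rw [convNrm, one_div, Real.rpow_inv_natCast_pow (E.nrm_nonneg (ha j)) hn0]
  by_cases hzero : ∃ j, E.convNrm n (a j) = 0
  · obtain ⟨j, hj⟩ := hzero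
    have hj0 : ∀ k, a j k = 0 := by
      intro k
      have h := hpow j
      rw [hj, zero_pow hn0] at h
      simpa [hn0] using congrFun ((E.nrm_eq_zero_iff (ha j)).1 h.symm) k
    have hprod : (fun k => ∏ j, a j k) = 0 :=
      funext fun k => Finset.prod_eq_zero (Finset.mem_univ j) (hj0 k)
    rw [hprod, E.nrm_zero]
    exact Finset.prod_nonneg fun j _ => hnonneg j
  push Not at hzero
  set t : Fin n → ℝ := fun j => E.convNrm n (a j) with ht
  have hscale : ∀ j, (fun k => Complex.ofReal (‖(t j : ℂ)⁻¹ * a j k‖ ^ n)) =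
      (((t j ^ n)⁻¹ : ℝ) : ℂ) • fun k => Complex.ofReal (‖a j k‖ ^ n) := by
    intro j
    funext k
    simp [mul_pow, abs_of_nonneg (hnonneg j), ht]
  have hmean := (E.mem_prod_and_nrm_prod_le_mean hn (fun j k => (t j : ℂ)⁻¹ * a j k) fun j => by
    rw [convMem, hscale]
    exact E.mem_smul _ (ha j)).2
  have hunit : ∀ j, E.nrm (fun k => Complex.ofReal (‖(t j : ℂ)⁻¹ * a j k‖ ^ n)) = 1 := by
    intro j
    rw [hscale, E.nrm_smul _ (ha j), ← hpow, Complex.norm_real,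
      Real.norm_of_nonneg (inv_nonneg.2 (pow_nonneg (hnonneg j) n))]
    exact inv_mul_cancel₀ (pow_ne_zero n (hzero j))
  have hfactor : (fun k => ∏ j, (t j : ℂ)⁻¹ * a j k) =
      (((∏ j, t j)⁻¹ : ℝ) : ℂ) • fun k => ∏ j, a j k := by
    funext k
    simp [Finset.prod_mul_distrib]
  have hpos : 0 < ∏ j, t j := Finset.prod_pos fun j _ => (hnonneg j).lt_of_ne' (hzero j)
  simp only [hunit] at hmean
  rw [hfactor, E.nrm_smul _ (E.mem_prod_and_nrm_prod_le_mean hn a ha).1, Complex.norm_real,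
    Real.norm_of_nonneg (inv_nonneg.2 hpos.le)] at hmean
  simp only [Finset.sum_const, Finset.card_univ, Fintype.card_fin, nsmul_eq_mul, mul_one] at hmean
  rwa [inv_mul_cancel₀ (Nat.cast_ne_zero.2 hn0), inv_mul_le_iff₀ hpos, mul_one] at hmean

end KotheSpace

/-- Composition theorem for `(E,p)`-summing multilinear mappings, part (ii):
if each `A_j : X_j → Y_j` is `(E^{1/n},p)`-summing with constant `C_j` and `T` is a
bounded `n`-linear map, then `T∘(A_1,…,A_n)` is `(E,p)`-summing with constant
`‖T‖·C_1⋯C_n`. -/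
theorem summing_comp_conv (n : ℕ) (hn : 1 ≤ n) (p : ℝ) (hp : 1 ≤ p) (E : KotheSpace)
    {X Y : Fin n → Type*} [∀ j, NormedAddCommGroup (X j)] [∀ j, NormedSpace ℂ (X j)]
    [∀ j, NormedAddCommGroup (Y j)] [∀ j, NormedSpace ℂ (Y j)]
    {Z : Type*} [NormedAddCommGroup Z] [NormedSpace ℂ Z]
    (T : ContinuousMultilinearMap ℂ Y Z)
    (A : ∀ j, X j →L[ℂ] Y j) (C : Fin n → ℝ)
    (hA : ∀ j, SummingIneqLin (E.convMem n) (E.convNrm n) p (A j) (C j)) :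
    SummingIneq E.Mem E.nrm p (T.compContinuousLinearMap A) (‖T‖ * ∏ j, C j) := by
  intro m x
  let a : Fin n → ℕ → ℂ := fun j i =>
    if h : i < m then Complex.ofReal ‖A j (x j ⟨i, h⟩)‖ else 0
  have ha : ∀ j, E.convMem n (a j) := fun j => (hA j m (x j)).1
  have hprod := (E.mem_prod_and_nrm_prod_le_mean hn a ha).1
  have hle : ∀ i, ‖if h : i < m then Complex.ofReal
      ‖T.compContinuousLinearMap A (fun j => x j ⟨i, h⟩)‖ else 0‖ ≤
      ‖((‖T‖ : ℂ) • fun k => ∏ j, a j k) i‖ := by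
    intro i
    by_cases h : i < m
    · simpa [a, h] using T.le_opNorm fun j => A j (x j ⟨i, h⟩)
    · simp only [h, dite_false, norm_zero, norm_nonneg]
  have hT := E.mem_smul (‖T‖ : ℂ) hprod
  have hmem := E.normal_mem hT hle
  refine ⟨hmem, (E.normal_nrm hmem hT hle).trans ?_⟩
  rw [E.nrm_smul _ hprod, Complex.norm_real, norm_norm, mul_assoc, ← Finset.prod_mul_distrib]
  gcongr
  exact (E.nrm_prod_le_prod_convNrm hn a ha).trans
    (Finset.prod_le_prod (fun j _ => Real.rpow_nonneg (E.nrm_nonneg (ha j)) _)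
      fun j _ => (hA j m (x j)).2)
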